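/- arXiv:2603.19560 — 5 statements merged into one kernel-verified Lean document; each statement's English description precedes it below -/
import Mathlib

section
/- For any pair of patterns (p₁, p₂), if there exists a pair of substitutions (σ₁, σ₂) that unifies (p₁, p₂) (i.e., σ₁[p₁] = σ₂[p₂]), then there exists a pair of substitutions that is a most general unifier for (p₁, p₂). -/
inductive Pattern (K X : Type) : Type
  | var : X → Pattern K X
  | con : K → List (Pattern K X) → Pattern K X

abbrev Subst (K X : Type) : Type := X → Pattern K X

def Pattern.subst {K X : Type} (σ : Subst K X) : Pattern K X → Pattern K X
  | .var x => σ x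
  | .con k ps => .con k (ps.attach.map fun q => Pattern.subst σ q.1)
termination_by p => sizeOf p
decreasing_by
  have := List.sizeOf_lt_of_mem q.2
  simp only [Pattern.con.sizeOf_spec]
  omega

def scomp {K X : Type} (σ₁ σ₂ : Subst K X) : Subst K X :=
  fun x => (σ₂ x).subst σ₁

def Factors {K X : Type} (σ₁ σ₂ : Subst K X) : Prop :=
  ∃ σ₃, σ₁ = scomp σ₃ σ₂

def Unifies {K X : Type} (σ₁ σ₂ : Subst K X) (p₁ p₂ : Pattern K X) : Prop :=
  p₁.subst σ₁ = p₂.subst σ₂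

def IsMGU {K X : Type} (σ₁ σ₂ : Subst K X) (p₁ p₂ : Pattern K X) : Prop :=
  Unifies σ₁ σ₂ p₁ p₂ ∧
  ∀ σ₁' σ₂' : Subst K X, Unifies σ₁' σ₂' p₁ p₂ → Factors σ₁' σ₁ ∧ Factors σ₂' σ₂

inductive IsGround {K X : Type} : Pattern K X → Prop
  | con (k : K) (ps : List (Pattern K X)) : (∀ p ∈ ps, IsGround p) → IsGround (.con k ps)

inductive VarOccurs {K X : Type} (x : X) : Pattern K X → Prop
  | var : VarOccurs x (.var x)
  | con (k : K) (ps : List (Pattern K X)) (p : Pattern K X) :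
      p ∈ ps → VarOccurs x p → VarOccurs x (.con k ps)

abbrev Rule (K X : Type) : Type := Pattern K X × Pattern K X

def Functional {K X : Type} (r : Rule K X) : Prop :=
  ∀ x, VarOccurs x r.2 → VarOccurs x r.1

def Step {K X : Type} (r : Rule K X) (t₁ t₂ : Pattern K X) : Prop :=
  ∃ σ : Subst K X, r.1.subst σ = t₁ ∧ r.2.subst σ = t₂

def ComposedBy {K X : Type} (r₁ r₂ r : Rule K X) : Prop :=
  ∃ σ₁ σ₂ : Subst K X, IsMGU σ₁ σ₂ r₁.2 r₂.1 ∧ r = (r₁.1.subst σ₁, r₂.2.subst σ₂)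

def RuleEquiv {K X : Type} (r r' : Rule K X) : Prop :=
  ∃ σ₁ σ₂ : Subst K X,
    r.1.subst σ₁ = r'.1 ∧ r.2.subst σ₁ = r'.2 ∧
    r'.1.subst σ₂ = r.1 ∧ r'.2.subst σ₂ = r.2

def StepSet {K X : Type} (R : Set (Rule K X)) (t₁ t₂ : Pattern K X) : Prop :=
  ∃ r ∈ R, Step r t₁ t₂

def Evaluates {K X : Type} (R : Set (Rule K X)) (t₁ t₂ : Pattern K X) : Prop :=
  Relation.ReflTransGen (StepSet R) t₁ t₂ ∧ ∀ t₃, ¬ StepSet R t₂ t₃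

namespace Pattern

variable {K X : Type}

theorem subst_con (σ : Subst K X) (k : K) (ps : List (Pattern K X)) :
    (con k ps).subst σ = con k (ps.map (subst σ)) := by
  simp [subst]

theorem subst_var (σ : Subst K X) (x : X) : (var x).subst σ = σ x := by
  simp [subst]

theorem induction_mem {P : Pattern K X → Prop} (hvar : ∀ x, P (var x))
    (hcon : ∀ k ps, (∀ p ∈ ps, P p) → P (con k ps)) : ∀ p, P p
  | var x => hvar x
  | con k ps => hcon k ps fun p _ => induction_mem hvar hcon p

theorem subst_congr {σ τ : Subst K X} (p : Pattern K X) :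
    (∀ x, VarOccurs x p → σ x = τ x) → p.subst σ = p.subst τ := by
  induction p using induction_mem with
  | hvar x => intro h; simpa only [subst_var] using h x .var
  | hcon k ps ih =>
    intro h
    simp only [subst_con, con.injEq, true_and]
    exact List.map_congr_left fun p hp => ih p hp fun x hx => h x (.con k ps p hp hx)

theorem subst_id (p : Pattern K X) : p.subst var = p := by
  induction p using induction_mem with
  | hvar x => exact subst_var _ x
  | hcon k ps ih =>
    rw [subst_con, List.map_congr_left ih, List.map_id']

theorem subst_subst (σ τ : Subst K X) (p : Pattern K X) :
    (p.subst τ).subst σ = p.subst (scomp σ τ) := by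
  induction p using induction_mem with
  | hvar x => simp only [subst_var, scomp]
  | hcon k ps ih =>
    simp only [subst_con, con.injEq, true_and, List.map_map]
    exact List.map_congr_left ih

theorem sizeOf_pos (p : Pattern K X) : 0 < sizeOf p := by
  cases p <;> simp

theorem sizeOf_le_of_varOccurs (θ : Subst K X) {x : X} {p : Pattern K X} (h : VarOccurs x p) :
    sizeOf (θ x) ≤ sizeOf (p.subst θ) := by
  induction h with
  | var => rw [subst_var]
  | con k ps p hp _ ih =>
    have := List.sizeOf_lt_of_mem (List.mem_map_of_mem (f := subst θ) hp)
    rw [subst_con, con.sizeOf_spec]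
    omega

theorem eq_var_of_varOccurs {θ : Subst K X} {x : X} {p : Pattern K X} (h : VarOccurs x p)
    (hθ : θ x = p.subst θ) : p = var x := by
  cases h with
  | var => rfl
  | con k ps p hp h =>
    have := List.sizeOf_lt_of_mem (List.mem_map_of_mem (f := subst θ) hp)
    have h2 := sizeOf_le_of_varOccurs θ h
    rw [subst_con] at hθ
    rw [hθ, con.sizeOf_spec] at h2
    omega

/-- `θ` solves every equation of the list `E`. -/
def Solves (θ : Subst K X) (E : List (Pattern K X × Pattern K X)) : Prop :=
  ∀ e ∈ E, e.1.subst θ = e.2.subst θ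

theorem solves_cons {θ : Subst K X} {p q : Pattern K X} {E : List (Pattern K X × Pattern K X)} :
    Solves θ ((p, q) :: E) ↔ p.subst θ = q.subst θ ∧ Solves θ E := by
  simp [Solves]

theorem solves_append {θ : Subst K X} {E F : List (Pattern K X × Pattern K X)} :
    Solves θ (E ++ F) ↔ Solves θ E ∧ Solves θ F :=
  List.forall_mem_append

theorem solves_map {θ ρ : Subst K X} {E : List (Pattern K X × Pattern K X)} :
    Solves θ (E.map (Prod.map (subst ρ) (subst ρ))) ↔ Solves (scomp θ ρ) E := by
  simp only [Solves, List.forall_mem_map, Prod.map_fst, Prod.map_snd, subst_subst]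

theorem solves_zip {θ : Subst K X} : ∀ {ps qs : List (Pattern K X)}, ps.length = qs.length →
    (Solves θ (ps.zip qs) ↔ ps.map (subst θ) = qs.map (subst θ))
  | [], [], _ => by simp [Solves]
  | p :: ps, q :: qs, h => by
    rw [List.zip_cons_cons, solves_cons, solves_zip (by simpa using h)]
    simp

/-- The total size of the left-hand sides of `E` after applying `θ`. -/
noncomputable def instSize (θ : Subst K X) (E : List (Pattern K X × Pattern K X)) : ℕ :=
  (E.map fun e => sizeOf (e.1.subst θ)).sum

theorem instSize_map (θ ρ : Subst K X) (E : List (Pattern K X × Pattern K X)) :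
    instSize θ (E.map (Prod.map (subst ρ) (subst ρ))) = instSize (scomp θ ρ) E := by
  simp [instSize, subst_subst, Function.comp_def]

theorem instSize_zip_le (θ : Subst K X) : ∀ ps qs : List (Pattern K X),
    instSize θ (ps.zip qs) ≤ sizeOf (ps.map (subst θ))
  | [], _ => by simp [instSize]
  | _ :: _, [] => by simp [instSize]
  | p :: ps, q :: qs => by
    have := instSize_zip_le θ ps qs
    simp only [instSize, List.zip_cons_cons, List.map_cons, List.sum_cons,
      List.cons.sizeOf_spec] at this ⊢
    omega

/-- `τ` is an idempotent most general solution of `E`. -/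
def IsPrincipal (τ : Subst K X) (E : List (Pattern K X × Pattern K X)) : Prop :=
  Solves τ E ∧ ∀ θ, Solves θ E → scomp θ τ = θ

theorem IsPrincipal.congr {τ : Subst K X} {E F : List (Pattern K X × Pattern K X)}
    (h : IsPrincipal τ E) (hEF : ∀ θ, Solves θ E ↔ Solves θ F) : IsPrincipal τ F :=
  ⟨(hEF τ).1 h.1, fun θ hθ => h.2 θ ((hEF θ).2 hθ)⟩

open Classical in
theorem scomp_update_var {θ : Subst K X} {x : X} {t : Pattern K X} (h : θ x = t.subst θ) :
    scomp θ (Function.update var x t) = θ := by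
  funext y
  by_cases hy : y = x
  · subst hy; simp [scomp, h]
  · simp [scomp, hy, subst_var]

theorem scomp_assoc (σ τ ρ : Subst K X) : scomp σ (scomp τ ρ) = scomp (scomp σ τ) ρ :=
  funext fun x => subst_subst σ τ (ρ x)

open Classical in
theorem IsPrincipal.cons_var {τ : Subst K X} {x : X} {t : Pattern K X}
    {E : List (Pattern K X × Pattern K X)} (hx : ¬ VarOccurs x t)
    (h : IsPrincipal τ
      (E.map (Prod.map (subst (Function.update var x t)) (subst (Function.update var x t))))) :
    IsPrincipal (scomp τ (Function.update var x t)) ((var x, t) :: E) := by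
  constructor
  · refine solves_cons.2 ⟨?_, solves_map.1 h.1⟩
    rw [← subst_subst, ← subst_subst, subst_var, Function.update_self]
    congr 1
    conv_lhs => rw [← subst_id t]
    refine subst_congr t fun y hy => (Function.update_of_ne ?_ _ _).symm
    rintro rfl
    exact hx hy
  · intro θ hθ
    obtain ⟨hxt, hE⟩ := solves_cons.1 hθ
    rw [subst_var] at hxt
    have hθρ := scomp_update_var hxt
    rw [scomp_assoc, h.2 θ (solves_map.2 (by rwa [hθρ])), hθρ]

theorem exists_isPrincipal (θ : Subst K X) (n : ℕ) : ∀ E, Solves θ E → instSize θ E ≤ n →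
    ∃ τ, IsPrincipal τ E := by
  classical
  induction n with
  | zero =>
    rintro (_ | ⟨⟨p, q⟩, E⟩) hE hn
    · exact ⟨var, by simp [Solves], fun θ _ => funext fun x => subst_var θ x⟩
    · have := sizeOf_pos (p.subst θ)
      simp [instSize] at hn
      omega
  | succ n ih =>
    have elim : ∀ x t E, Solves θ ((var x, t) :: E) → instSize θ E ≤ n →
        ∃ τ, IsPrincipal τ ((var x, t) :: E) := by
      intro x t E h hn
      obtain ⟨hxt, hE⟩ := solves_cons.1 h
      rw [subst_var] at hxt
      by_cases hx : VarOccurs x t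
      · obtain rfl := eq_var_of_varOccurs hx hxt
        obtain ⟨τ, hτ⟩ := ih E hE hn
        exact ⟨τ, hτ.congr fun θ => by simp [solves_cons]⟩
      · have hθρ := scomp_update_var hxt
        obtain ⟨τ, hτ⟩ := ih _ (solves_map.2 (by rwa [hθρ]))
          (by rwa [instSize_map, hθρ])
        exact ⟨_, hτ.cons_var hx⟩
    rintro (_ | ⟨⟨p, q⟩, E⟩) hE hn
    · exact ih [] hE (by simp [instSize])
    · have hn' : sizeOf (p.subst θ) + instSize θ E ≤ n + 1 := by simpa [instSize] using hn
      have hp := sizeOf_pos (p.subst θ)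
      cases p with
      | var x => exact elim x q E hE (by omega)
      | con k ps =>
        cases q with
        | var x =>
          have swap : ∀ θ : Subst K X, Solves θ ((var x, con k ps) :: E) ↔
              Solves θ ((con k ps, var x) :: E) := fun θ => by
            rw [solves_cons, solves_cons, eq_comm]
          obtain ⟨τ, hτ⟩ := elim x (con k ps) E ((swap θ).2 hE) (by omega)
          exact ⟨τ, hτ.congr swap⟩
        | con l qs =>
          have hpq := (solves_cons.1 hE).1
          simp only [subst_con, con.injEq] at hpq
          obtain ⟨rfl, hpq⟩ := hpq
          have hlen : ps.length = qs.length := by simpa using congrArg List.length hpq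
          have decomp : ∀ θ : Subst K X, Solves θ (ps.zip qs ++ E) ↔
              Solves θ ((con k ps, con k qs) :: E) := fun θ => by
            simp [solves_append, solves_cons, solves_zip hlen, subst_con]
          have hz := instSize_zip_le θ ps qs
          rw [subst_con, con.sizeOf_spec] at hn'
          have happ : instSize θ (ps.zip qs ++ E) = instSize θ (ps.zip qs) + instSize θ E := by
            simp [instSize]
          obtain ⟨τ, hτ⟩ := ih _ ((decomp θ).2 hE) (by omega)
          exact ⟨τ, hτ.congr decomp⟩

end Pattern

theorem mgu_exists {K X : Type} [Countable X] [Infinite X]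
    (p₁ p₂ : Pattern K X)
    (h : ∃ σ₁ σ₂ : Subst K X, Unifies σ₁ σ₂ p₁ p₂) :
    ∃ σ₁ σ₂ : Subst K X, IsMGU σ₁ σ₂ p₁ p₂ := by
  obtain ⟨e⟩ : Nonempty (X ⊕ X ≃ X) := nonempty_equiv_of_countable
  let inl : Subst K X := fun x => .var (e (.inl x))
  let inr : Subst K X := fun x => .var (e (.inr x))
  let join : Subst K X → Subst K X → Subst K X := fun σ₁ σ₂ y => Sum.elim σ₁ σ₂ (e.symm y)
  have join_inl : ∀ σ₁ σ₂, scomp (join σ₁ σ₂) inl = σ₁ := fun σ₁ σ₂ => by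
    funext x; simp [scomp, inl, join, Pattern.subst_var]
  have join_inr : ∀ σ₁ σ₂, scomp (join σ₁ σ₂) inr = σ₂ := fun σ₁ σ₂ => by
    funext x; simp [scomp, inr, join, Pattern.subst_var]
  have solves_iff : ∀ θ, Pattern.Solves θ [(p₁.subst inl, p₂.subst inr)] ↔
      Unifies (scomp θ inl) (scomp θ inr) p₁ p₂ := fun θ => by
    simp [Pattern.Solves, Unifies, Pattern.subst_subst]
  have solves_join : ∀ σ₁ σ₂, Unifies σ₁ σ₂ p₁ p₂ →
      Pattern.Solves (join σ₁ σ₂) [(p₁.subst inl, p₂.subst inr)] := fun σ₁ σ₂ hσ => by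
    rwa [solves_iff, join_inl, join_inr]
  obtain ⟨σ₁, σ₂, hσ⟩ := h
  obtain ⟨τ, hτ, hmost⟩ := Pattern.exists_isPrincipal _ _ _ (solves_join σ₁ σ₂ hσ) le_rfl
  refine ⟨scomp τ inl, scomp τ inr, (solves_iff τ).1 hτ, fun σ₁' σ₂' hσ' => ?_⟩
  have hj := hmost _ (solves_join σ₁' σ₂' hσ')
  exact ⟨⟨join σ₁' σ₂', by rw [Pattern.scomp_assoc, hj, join_inl]⟩,
    ⟨join σ₁' σ₂', by rw [Pattern.scomp_assoc, hj, join_inr]⟩⟩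
end

section
/- If r = (p₁ ↦ p₂) is a functional rewrite rule and a term t steps to t₂ by r and also steps to t₃ by r, then t₂ = t₃; that is, the single-rule step relation of a functional rule is a partial function on terms. -/
theorem Pattern.subst_con_s1 {K X : Type} (σ : Subst K X) (k : K) (ps : List (Pattern K X)) :
    (Pattern.con k ps).subst σ = .con k (ps.map (Pattern.subst σ)) := by
  rw [Pattern.subst, List.attach_map_val]

/-- Equal instances of a pattern come from substitutions that agree on its variables. -/
theorem VarOccurs.eq_of_subst_eq {K X : Type} {x : X} {p : Pattern K X} (hx : VarOccurs x p)
    {σ τ : Subst K X} (h : p.subst σ = p.subst τ) : σ x = τ x := by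
  induction hx with
  | var => simpa only [Pattern.subst] using h
  | con k ps p hp _ ih =>
    simp only [Pattern.subst_con_s1, Pattern.con.injEq, true_and, List.map_inj_left] at h
    exact ih (h p hp)

/-- Substitutions that agree on the variables of a pattern give equal instances of it. -/
theorem Pattern.subst_congr_s1 {K X : Type} {σ τ : Subst K X} :
    (p : Pattern K X) → (∀ x, VarOccurs x p → σ x = τ x) → p.subst σ = p.subst τ
  | .var x, h => by simpa only [Pattern.subst] using h x .var
  | .con k ps, h => by
    simp only [Pattern.subst_con_s1, Pattern.con.injEq, true_and, List.map_inj_left]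
    exact fun p hp => Pattern.subst_congr_s1 p fun x hx => h x (.con k ps p hp hx)
termination_by p => sizeOf p
decreasing_by
  have := List.sizeOf_lt_of_mem hp
  simp only [Pattern.con.sizeOf_spec]
  omega

theorem step_functional_deterministic {K X : Type} [Countable X] [Infinite X]
    (p₁ p₂ : Pattern K X) (hfun : Functional (p₁, p₂))
    (t t₂ t₃ : Pattern K X) (ht : IsGround t) (ht₂ : IsGround t₂) (ht₃ : IsGround t₃)
    (h₂ : Step (p₁, p₂) t t₂) (h₃ : Step (p₁, p₂) t t₃) : t₂ = t₃ := by
  obtain ⟨σ, hσ₁, rfl⟩ := h₂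
  obtain ⟨τ, hτ₁, rfl⟩ := h₃
  exact Pattern.subst_congr_s1 p₂ fun x hx => (hfun x hx).eq_of_subst_eq (hσ₁.trans hτ₁.symm)
end

section
/- (Shortcut Validity) Let R be a set of functional rewrite rules, let r₁, r₂ ∈ R, and suppose the composition r₁ ∘ r₂ exists. Then the rule sets R ∪ {r₁ ∘ r₂} and R are equivalent: for all terms t₁ and t₂, t₁ evaluates to t₂ under R ∪ {r₁ ∘ r₂} if and only if t₁ evaluates to t₂ under R. -/
theorem Pattern.subst_subst_s5 {K X : Type} (σ τ : Subst K X) :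
    ∀ p : Pattern K X, (p.subst τ).subst σ = p.subst (scomp σ τ)
  | .var x => by simp [Pattern.subst, scomp]
  | .con k ps => by
    simp only [Pattern.subst, List.map_subtype, List.unattach_attach, List.map_map,
      Pattern.con.injEq, true_and]
    exact List.map_congr_left fun q _ => Pattern.subst_subst_s5 σ τ q

/-- A step by a composed rule is a step by the first rule followed by a step by the second. -/
theorem ComposedBy.step_step {K X : Type} {r₁ r₂ r : Rule K X} (hc : ComposedBy r₁ r₂ r)
    {a b : Pattern K X} (h : Step r a b) : ∃ c, Step r₁ a c ∧ Step r₂ c b := by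
  obtain ⟨σ₁, σ₂, ⟨hu, -⟩, rfl⟩ := hc
  obtain ⟨σ, rfl, rfl⟩ := h
  refine ⟨(r₁.2.subst σ₁).subst σ,
    ⟨scomp σ σ₁, (Pattern.subst_subst_s5 ..).symm, (Pattern.subst_subst_s5 ..).symm⟩,
    ⟨scomp σ σ₂, ?_, (Pattern.subst_subst_s5 ..).symm⟩⟩
  rw [← Pattern.subst_subst_s5, ← hu]

theorem shortcut_validity {K X : Type} [Countable X] [Infinite X]
    (R : Set (Rule K X)) (hR : ∀ r ∈ R, Functional r)
    (r₁ r₂ : Rule K X) (h₁ : r₁ ∈ R) (h₂ : r₂ ∈ R)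
    (r : Rule K X) (hc : ComposedBy r₁ r₂ r)
    (t₁ t₂ : Pattern K X) (hg₁ : IsGround t₁) (hg₂ : IsGround t₂) :
    Evaluates (R ∪ {r}) t₁ t₂ ↔ Evaluates R t₁ t₂ := by
  have hsplit {a b : Pattern K X} (h : Step r a b) :
      ∃ c, StepSet R a c ∧ StepSet R c b :=
    let ⟨c, hac, hcb⟩ := hc.step_step h
    ⟨c, ⟨r₁, h₁, hac⟩, ⟨r₂, h₂, hcb⟩⟩
  have hmono {a b : Pattern K X} : StepSet R a b → StepSet (R ∪ {r}) a b :=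
    fun ⟨q, hq, hs⟩ => ⟨q, Or.inl hq, hs⟩
  constructor
  · rintro ⟨hsteps, hnf⟩
    refine ⟨?_, fun t₃ h => hnf t₃ (hmono h)⟩
    clear hg₁
    induction hsteps using Relation.ReflTransGen.head_induction_on with
    | refl => exact .refl
    | head hstep _ ih =>
      obtain ⟨q, hq | rfl, hs⟩ := hstep
      · exact .head ⟨q, hq, hs⟩ ih
      · obtain ⟨c, hac, hcb⟩ := hsplit hs
        exact .head hac (.head hcb ih)
  · rintro ⟨hsteps, hnf⟩
    refine ⟨Relation.ReflTransGen.mono (fun _ _ => hmono) _ _ hsteps, ?_⟩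
    rintro t₃ ⟨q, hq | rfl, hs⟩
    · exact hnf t₃ ⟨q, hq, hs⟩
    · obtain ⟨c, hac, -⟩ := hsplit hs
      exact hnf c hac
end

section
/- (Functionality is preserved by composition) If r₁ = (p₁ ↦ p₂) and r₂ = (p₃ ↦ p₄) are functional rewrite rules and their composition r₁ ∘ r₂ exists, then r₁ ∘ r₂ is a functional rule: every pattern variable occurring in its right-hand side also occurs in its left-hand side. -/
theorem Pattern.varOccurs_subst_iff {K X : Type} (σ : Subst K X) (x : X) (p : Pattern K X) :
    VarOccurs x (p.subst σ) ↔ ∃ y, VarOccurs y p ∧ VarOccurs x (σ y) := by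
  constructor
  · intro h
    induction p using Pattern.subst.induct with
    | case1 z =>
      rw [Pattern.subst] at h
      exact ⟨z, .var, h⟩
    | case2 k ps ih =>
      rw [Pattern.subst] at h
      cases h with
      | con _ _ q hq hx =>
        obtain ⟨p, -, rfl⟩ := List.mem_map.1 hq
        obtain ⟨y, hy, hxy⟩ := ih p hx
        exact ⟨y, .con k ps p.1 p.2 hy, hxy⟩
  · rintro ⟨y, hy, hx⟩
    induction hy with
    | var => rwa [Pattern.subst]
    | con k ps p hp _ ih =>
      rw [Pattern.subst]
      exact .con _ _ _ (List.mem_map.2 ⟨⟨p, hp⟩, List.mem_attach _ _, rfl⟩) ih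

theorem composition_functional {K X : Type} [Countable X] [Infinite X]
    (r₁ r₂ : Rule K X) (hf₁ : Functional r₁) (hf₂ : Functional r₂)
    (r : Rule K X) (hc : ComposedBy r₁ r₂ r) : Functional r := by
  obtain ⟨σ₁, σ₂, ⟨hu, -⟩, rfl⟩ := hc
  intro x hx
  obtain ⟨y, hy, hxy⟩ := (Pattern.varOccurs_subst_iff σ₂ x r₂.2).1 hx
  have hx' := (Pattern.varOccurs_subst_iff σ₂ x r₂.1).2 ⟨y, hf₂ y hy, hxy⟩
  rw [← show r₁.2.subst σ₁ = r₂.1.subst σ₂ from hu] at hx'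
  obtain ⟨z, hz, hxz⟩ := (Pattern.varOccurs_subst_iff σ₁ x r₁.2).1 hx'
  exact (Pattern.varOccurs_subst_iff σ₁ x r₁.1).2 ⟨z, hf₁ z hz, hxz⟩
end

section
/- (Monoidal parsing correctness) Assign to each constructor k of arity a the degree 1 − a, and define the degree of a finite sequence of constructors as the sum of the degrees of its entries. Let s be the preorder traversal of a term t (the sequence of constructors of t listed in preorder). Then the degree of s equals 1, and every nonempty proper prefix of s has degree at most 0; consequently, s is the unique nonempty prefix of itself whose degree equals 1. -/
/-- A term over constructors `K`, where constructor `k` has arity `ar k`: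
a constructor applied to exactly `ar k` (ordered) child terms. -/
inductive Tm (K : Type) (ar : K → ℕ) : Type
  | mk : (k : K) → (Fin (ar k) → Tm K ar) → Tm K ar

/-- Preorder traversal: the root constructor followed by the concatenated
preorder traversals of the children, in order. -/
def Tm.trav {K : Type} {ar : K → ℕ} : Tm K ar → List K
  | .mk k ts => k :: (List.ofFn fun i => Tm.trav (ts i)).flatten

/-- The degree of a finite sequence of constructors: the sum over entries of `1 - arity`. -/
def deg {K : Type} (ar : K → ℕ) (s : List K) : ℤ :=
  (s.map fun k => 1 - (ar k : ℤ)).sum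

theorem deg_cons {K : Type} (ar : K → ℕ) (k : K) (s : List K) :
    deg ar (k :: s) = 1 - (ar k : ℤ) + deg ar s := by
  simp [deg]

theorem deg_append {K : Type} (ar : K → ℕ) (s s' : List K) :
    deg ar (s ++ s') = deg ar s + deg ar s' := by
  simp [deg]

theorem deg_flatten {K : Type} (ar : K → ℕ) (L : List (List K))
    (h : ∀ l ∈ L, deg ar l = 1) : deg ar L.flatten = L.length := by
  induction L with
  | nil => simp [deg]
  | cons l L ih =>
    rw [List.flatten_cons, deg_append, h l (by simp), ih fun m hm => h m (by simp [hm])]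
    push_cast [List.length_cons]
    ring

theorem deg_lt_length_of_prefix_flatten {K : Type} (ar : K → ℕ) (L : List (List K))
    (h : ∀ l ∈ L, deg ar l = 1 ∧ ∀ u : List K, u <+: l → u ≠ l → deg ar u ≤ 0)
    (u : List K) (hu : u <+: L.flatten) (hne : u ≠ L.flatten) :
    deg ar u < L.length := by
  induction L generalizing u with
  | nil => exact absurd (List.prefix_nil.mp hu) hne
  | cons l L ih =>
    obtain ⟨hl, hpre⟩ := h l (by simp)
    have hL := ih fun m hm => h m (by simp [hm])
    rw [List.flatten_cons] at hu hne
    have split : (u <+: l ∧ u ≠ l) ∨ ∃ v, u = l ++ v := by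
      rcases List.prefix_or_prefix_of_prefix hu (List.prefix_append l L.flatten) with hul | ⟨v, hv⟩
      · by_cases hul' : u = l
        · exact Or.inr ⟨[], by simpa using hul'⟩
        · exact Or.inl ⟨hul, hul'⟩
      · exact Or.inr ⟨v, hv.symm⟩
    push_cast [List.length_cons]
    rcases split with ⟨hul, hul'⟩ | ⟨v, rfl⟩
    · have := hpre u hul hul'
      omega
    · have := hL v ((List.prefix_append_right_inj l).mp hu) fun hv => hne (by rw [hv])
      rw [deg_append, hl]
      omega

theorem Tm.deg_trav_and_deg_prefix_le {K : Type} (ar : K → ℕ) (t : Tm K ar) :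
    deg ar t.trav = 1 ∧ ∀ u : List K, u <+: t.trav → u ≠ t.trav → deg ar u ≤ 0 := by
  induction t with
  | mk k ts ih =>
    have hts : ∀ l ∈ List.ofFn fun i => (ts i).trav,
        deg ar l = 1 ∧ ∀ u : List K, u <+: l → u ≠ l → deg ar u ≤ 0 := by
      intro l hl
      obtain ⟨i, rfl⟩ := List.mem_ofFn.mp hl
      exact ih i
    rw [Tm.trav]
    refine ⟨?_, fun u hu hne => ?_⟩
    · rw [deg_cons, deg_flatten ar _ fun l hl => (hts l hl).1, List.length_ofFn]
      ring
    · rcases List.prefix_cons_iff.mp hu with rfl | ⟨v, rfl, hv⟩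
      · simp [deg]
      · have := deg_lt_length_of_prefix_flatten ar _ hts v hv fun h => hne (by rw [h])
        rw [List.length_ofFn] at this
        rw [deg_cons]
        omega

theorem monoidal_parsing_correct {K : Type} (ar : K → ℕ) (t : Tm K ar) :
    deg ar t.trav = 1 ∧
    (∀ u : List K, u <+: t.trav → u ≠ [] → u ≠ t.trav → deg ar u ≤ 0) ∧
    (∀ u : List K, u <+: t.trav → u ≠ [] → deg ar u = 1 → u = t.trav) := by
  obtain ⟨hdeg, hpre⟩ := t.deg_trav_and_deg_prefix_le ar
  refine ⟨hdeg, fun u hu _ hne => hpre u hu hne, fun u hu _ hu1 => ?_⟩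
  by_contra hne
  have := hpre u hu hne
  omega
end
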